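/- For every positive integer n, every real β with 0 ≤ β < 1, and every x ≥ 0, the Jain operator applied to t³ satisfies B_n^β(t³, x) = x³/(1−β)³ + 3x²/(n(1−β)⁴) + (1+2β)x/(n²(1−β)⁵); applied to t⁴ it satisfies B_n^β(t⁴, x) = x⁴/(1−β)⁴ + 6x³/(n(1−β)⁵) + (7+8β)x²/(n²(1−β)⁶) + (6β²+8β+1)x/(n³(1−β)⁷); and applied to t⁵ it satisfies B_n^β(t⁵, x) = x⁵/(1−β)⁵ + 10x⁴/(n(1−β)⁶) + 5(4β+5)x³/(n²(1−β)⁷) + 15(2β²+4β+1)x²/(n³(1−β)⁸) + (24β³+58β²+22β+1)x/(n⁴(1−β)⁹). -/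

import Mathlib

open MeasureTheory Real Filter

/-- Jain basis function `L_{n,k}^{(β)}(t) = (n t (n t + k β)^{k-1} / k!) e^{-(n t + k β)}`. -/
noncomputable def jainL (n : ℕ) (β : ℝ) (k : ℕ) (t : ℝ) : ℝ :=
  (n : ℝ) * t * ((n : ℝ) * t + (k : ℝ) * β) ^ ((k : ℤ) - 1) / (Nat.factorial k : ℝ) *
    Real.exp (-((n : ℝ) * t + (k : ℝ) * β))

/-- Jain operator `B_n^β(f, x) = Σ_{k=0}^∞ L_{n,k}^{(β)}(x) f(k/n)`. -/
noncomputable def jainB (n : ℕ) (β : ℝ) (f : ℝ → ℝ) (x : ℝ) : ℝ :=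
  ∑' k : ℕ, jainL n β k x * f ((k : ℝ) / (n : ℝ))
/-- Mass at `k` of the generalized Poisson law with parameters `α` and `β`. -/
noncomputable def genPoisson (β : ℝ) : ℕ → ℝ → ℝ
  | 0, α => exp (-α)
  | k + 1, α => α * (α + (k + 1) * β) ^ k / (Nat.factorial (k + 1) : ℝ) *
      exp (-(α + (k + 1) * β))

lemma genPoisson_nonneg {β : ℝ} (hβ : 0 ≤ β) (k : ℕ) {α : ℝ} (hα : 0 ≤ α) :
    0 ≤ genPoisson β k α := by
  cases k <;> simp only [genPoisson] <;> positivity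

lemma hasDerivAt_genPoisson_zero (β α : ℝ) :
    HasDerivAt (genPoisson β 0) (-genPoisson β 0 α) α := by
  have h := ((hasDerivAt_id α).neg).exp
  have e : genPoisson β 0 = fun y => exp (-y) := by
    funext y; simp [genPoisson]
  rw [e]
  simpa using h

lemma hasDerivAt_genPoisson_succ (β : ℝ) (k : ℕ) (α : ℝ) :
    HasDerivAt (genPoisson β (k + 1))
      (genPoisson β k (α + β) - genPoisson β (k + 1) α) α := by
  have e : genPoisson β (k + 1) = fun y => y * (y + (k + 1) * β) ^ k /
      (Nat.factorial (k + 1) : ℝ) * exp (-(y + (k + 1) * β)) := by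
    funext y; simp [genPoisson]
  have h0 : HasDerivAt (fun y : ℝ => y + (k + 1) * β) 1 α := (hasDerivAt_id α).add_const _
  have h := (((hasDerivAt_id α).mul (h0.pow k)).div_const (Nat.factorial (k + 1) : ℝ)).mul
    h0.neg.exp
  rw [e]
  refine h.congr_deriv ?_
  cases k with
  | zero =>
    simp [genPoisson]
    ring
  | succ k =>
    have e1 : α + β + ((k : ℝ) + 1) * β = α + ((k : ℝ) + 1 + 1) * β := by ring
    simp only [genPoisson, Nat.factorial_succ, id, Pi.mul_apply, Pi.pow_apply, Pi.neg_apply]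
    push_cast
    rw [e1]
    have hk : (Nat.factorial k : ℝ) ≠ 0 := by positivity
    have hk1 : (k : ℝ) + 1 ≠ 0 := by positivity
    have hk2 : (k : ℝ) + 1 + 1 ≠ 0 := by positivity
    field_simp
    ring

lemma continuous_genPoisson (β : ℝ) (k : ℕ) : Continuous (genPoisson β k) := by
  cases k with
  | zero =>
    exact continuous_iff_continuousAt.2 fun α => (hasDerivAt_genPoisson_zero β α).continuousAt
  | succ k =>
    exact continuous_iff_continuousAt.2 fun α => (hasDerivAt_genPoisson_succ β k α).continuousAt

/-- A weighted partial sum differentiates to the shifted partial sum at `α + β` minus itself. -/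
lemma hasDerivAt_sum_genPoisson (β : ℝ) (w : ℕ → ℝ) (K : ℕ) (α : ℝ) :
    HasDerivAt (fun a => ∑ k ∈ Finset.range (K + 1), w k * genPoisson β k a)
      (∑ k ∈ Finset.range K, w (k + 1) * genPoisson β k (α + β) -
        ∑ k ∈ Finset.range (K + 1), w k * genPoisson β k α) α := by
  induction K with
  | zero =>
    simpa using (hasDerivAt_genPoisson_zero β α).const_mul (w 0)
  | succ K ih =>
    have h := ih.add ((hasDerivAt_genPoisson_succ β K α).const_mul (w (K + 1)))
    have e : (fun a => ∑ k ∈ Finset.range (K + 1 + 1), w k * genPoisson β k a) =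
        (fun a => ∑ k ∈ Finset.range (K + 1), w k * genPoisson β k a) +
          fun a => w (K + 1) * genPoisson β (K + 1) a := by
      funext a; simp [Finset.sum_range_succ]
    rw [e]
    refine h.congr_deriv ?_
    rw [Finset.sum_range_succ (fun k => w (k + 1) * _) K,
      Finset.sum_range_succ (fun k => w k * _) (K + 1)]
    ring

lemma nonneg_of_deriv_add_nonneg {f f' : ℝ → ℝ} (hf : ∀ a, HasDerivAt f (f' a) a)
    (h0 : f 0 = 0) (h : ∀ a, 0 ≤ a → 0 ≤ f' a + f a) {a : ℝ} (ha : 0 ≤ a) : 0 ≤ f a := by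
  have hd : ∀ x, HasDerivAt (fun y => exp y * f y) (exp x * f x + exp x * f' x) x :=
    fun x => (Real.hasDerivAt_exp x).mul (hf x)
  have hm : MonotoneOn (fun y => exp y * f y) (Set.Ici 0) := by
    refine monotoneOn_of_deriv_nonneg (convex_Ici 0)
      (fun x _ => (hd x).continuousAt.continuousWithinAt)
      (fun x _ => (hd x).differentiableAt.differentiableWithinAt) fun x hx => ?_
    rw [interior_Ici] at hx
    rw [(hd x).deriv]
    have := mul_nonneg (exp_pos x).le (h x (le_of_lt hx))
    linarith
  have := hm (Set.mem_Ici.2 le_rfl) (Set.mem_Ici.2 ha) ha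
  simp only [h0, mul_zero] at this
  exact nonneg_of_mul_nonneg_right this (exp_pos a)

/-- A nonnegative function of polynomial growth whose value at `a` is at most `β` times any bound
on `[a, a + β]` vanishes. -/
lemma eq_zero_of_le_mul_bound {β : ℝ} (hβ0 : 0 ≤ β) (hβ1 : β < 1) {G : ℝ → ℝ}
    (hG0 : ∀ a, 0 ≤ a → 0 ≤ G a) {C : ℝ} {d : ℕ} (hC : 0 ≤ C)
    (hG : ∀ a, 0 ≤ a → G a ≤ C * (1 + a) ^ d)
    (h : ∀ a, 0 ≤ a → ∀ B, (∀ s ∈ Set.Icc a (a + β), G s ≤ B) → G a ≤ β * B)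
    {a : ℝ} (ha : 0 ≤ a) : G a = 0 := by
  have key : ∀ (n : ℕ) (a : ℝ), 0 ≤ a → G a ≤ β ^ n * (C * (1 + (a + n * β)) ^ d) := by
    intro n
    induction n with
    | zero => intro a ha; simpa using hG a ha
    | succ n ih =>
      intro a ha
      convert (h a ha (β ^ n * (C * (1 + (a + (n + 1) * β)) ^ d)) fun s hs => ?_).trans_eq ?_
      · have hs0 : 0 ≤ s := ha.trans hs.1
        refine (ih s hs0).trans ?_
        have : s + n * β ≤ a + (n + 1) * β := by linarith [hs.2]
        gcongr
      · push_cast; ring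
  have ht : Tendsto (fun n : ℕ => C * (2 + a) ^ d * ((n : ℝ) ^ d * β ^ n)) atTop (nhds 0) := by
    simpa using (tendsto_pow_const_mul_const_pow_of_abs_lt_one d
      (by rwa [abs_of_nonneg hβ0])).const_mul (C * (2 + a) ^ d)
  refine le_antisymm (ge_of_tendsto ht ?_) (hG0 a ha)
  filter_upwards [eventually_ge_atTop 1] with n hn
  have hn' : (1 : ℝ) ≤ n := by exact_mod_cast hn
  refine (key n a ha).trans ?_
  have : 1 + (a + n * β) ≤ n * (2 + a) := by nlinarith
  calc β ^ n * (C * (1 + (a + n * β)) ^ d) ≤ β ^ n * (C * (n * (2 + a)) ^ d) := by gcongr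
    _ = _ := by rw [mul_pow]; ring

/-- If `w (k + 1) = w k + p k` and `q` is the mean of `p`, then a function `m` of polynomial growth
solving the delay equation satisfied by the mean of `w` is that mean. -/
lemma hasSum_genPoisson_of_delay {β : ℝ} (hβ0 : 0 ≤ β) (hβ1 : β < 1) {w p : ℕ → ℝ}
    {m m' q : ℝ → ℝ} (hp : ∀ k, 0 ≤ p k) (hw0 : 0 ≤ w 0) (hw : ∀ k, w (k + 1) = w k + p k)
    (hqc : Continuous q)
    (hq : ∀ a, 0 ≤ a → HasSum (fun k => p k * genPoisson β k a) (q a))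
    (hm : ∀ a, HasDerivAt m (m' a) a)
    (hm' : ∀ a, m' a = m (a + β) + q (a + β) - m a) (hm0 : m 0 = w 0)
    (hmn : ∀ a, 0 ≤ a → 0 ≤ m a) {C : ℝ} {d : ℕ} (hC : 0 ≤ C)
    (hmC : ∀ a, 0 ≤ a → m a ≤ C * (1 + a) ^ d) {a : ℝ} (ha : 0 ≤ a) :
    HasSum (fun k => w k * genPoisson β k a) (m a) := by
  have hwn : ∀ k, 0 ≤ w k := by
    intro k
    induction k with
    | zero => exact hw0
    | succ k ih => rw [hw]; linarith [hp k]
  have hterm : ∀ k a, 0 ≤ a → 0 ≤ w k * genPoisson β k a := fun k a ha =>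
    mul_nonneg (hwn k) (genPoisson_nonneg hβ0 k ha)
  set D : ℕ → ℝ → ℝ := fun K a => m a - ∑ k ∈ Finset.range K, w k * genPoisson β k a with hD
  set R : ℕ → ℝ → ℝ := fun K a => q a - ∑ k ∈ Finset.range K, p k * genPoisson β k a with hR
  have hmc : Continuous m := continuous_iff_continuousAt.2 fun a => (hm a).continuousAt
  have hDc : ∀ K, Continuous (D K) := fun K => hmc.sub
    (continuous_finsetSum _ fun k _ => (continuous_genPoisson β k).const_mul (w k))
  have hRc : ∀ K, Continuous (R K) := fun K => hqc.sub
    (continuous_finsetSum _ fun k _ => (continuous_genPoisson β k).const_mul (p k))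
  have hRn : ∀ K a, 0 ≤ a → 0 ≤ R K a := fun K a ha => sub_nonneg.2
    (sum_le_hasSum _ (fun k _ => mul_nonneg (hp k) (genPoisson_nonneg hβ0 k ha)) (hq a ha))
  have hRq : ∀ K a, 0 ≤ a → R K a ≤ q a := fun K a ha => sub_le_self _
    (Finset.sum_nonneg fun k _ => mul_nonneg (hp k) (genPoisson_nonneg hβ0 k ha))
  have hDm : ∀ K a, 0 ≤ a → D K a ≤ m a := fun K a ha => sub_le_self _
    (Finset.sum_nonneg fun k _ => hterm k a ha)
  have hRlim : ∀ a, 0 ≤ a → Tendsto (fun K => R K a) atTop (nhds 0) := fun a ha => by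
    simpa using (hq a ha).tendsto_sum_nat.const_sub (q a)
  have hDd : ∀ K a, HasDerivAt (D (K + 1)) (D K (a + β) + R K (a + β) - D (K + 1) a) a := by
    intro K a
    refine ((hm a).sub (hasDerivAt_sum_genPoisson β w K a)).congr_deriv ?_
    simp only [hD, hR, hm', hw, add_mul, Finset.sum_add_distrib]
    ring
  have hD0 : ∀ K, D (K + 1) 0 = 0 := by
    intro K
    simp [hD, Finset.sum_range_succ', hm0, genPoisson]
  have hDn : ∀ K a, 0 ≤ a → 0 ≤ D K a := by
    intro K
    induction K with
    | zero => intro a ha; simpa [hD] using hmn a ha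
    | succ K ih =>
      intro a ha
      refine nonneg_of_deriv_add_nonneg (hDd K) (hD0 K) (fun b hb => ?_) ha
      linarith [ih (b + β) (by positivity), hRn K (b + β) (by positivity)]
  have hsum : ∀ a, 0 ≤ a → Summable fun k => w k * genPoisson β k a := fun a ha =>
    summable_of_sum_range_le (fun k => hterm k a ha) fun K => sub_nonneg.1 (hDn K a ha)
  set G : ℝ → ℝ := fun a => m a - ∑' k, w k * genPoisson β k a with hG
  have hDlim : ∀ a, 0 ≤ a → Tendsto (fun K => D K a) atTop (nhds (G a)) := fun a ha =>
    (hsum a ha).hasSum.tendsto_sum_nat.const_sub (m a)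
  have hGn : ∀ a, 0 ≤ a → 0 ≤ G a := fun a ha =>
    ge_of_tendsto' (hDlim a ha) fun K => hDn K a ha
  have hGC : ∀ a, 0 ≤ a → G a ≤ C * (1 + a) ^ d := fun a ha =>
    (le_of_tendsto' (hDlim a ha) fun K => hDm K a ha).trans (hmC a ha)
  have hint : ∀ s t, 0 ≤ s → s ≤ t → Tendsto (fun K => ∫ u in s..t, D K u) atTop
      (nhds (∫ u in s..t, G u)) := by
    intro s t hs hst
    refine intervalIntegral.tendsto_integral_filter_of_dominated_convergence m
      (Eventually.of_forall fun K => (hDc K).aestronglyMeasurable)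
      (Eventually.of_forall fun K => ae_of_all _ fun u hu => ?_)
      (hmc.intervalIntegrable _ _) (ae_of_all _ fun u hu => ?_)
    all_goals
      rw [Set.uIoc_of_le hst] at hu
      have hu0 : 0 ≤ u := hs.trans hu.1.le
    · rw [Real.norm_of_nonneg (hDn K u hu0)]
      exact hDm K u hu0
    · exact hDlim u hu0
  have hintR : ∀ s t, 0 ≤ s → s ≤ t → Tendsto (fun K => ∫ u in s..t, R K u) atTop (nhds 0) := by
    intro s t hs hst
    have : Tendsto (fun K => ∫ u in s..t, R K u) atTop (nhds (∫ _u in s..t, (0 : ℝ))) := by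
      refine intervalIntegral.tendsto_integral_filter_of_dominated_convergence q
        (Eventually.of_forall fun K => (hRc K).aestronglyMeasurable)
        (Eventually.of_forall fun K => ae_of_all _ fun u hu => ?_)
        (hqc.intervalIntegrable _ _) (ae_of_all _ fun u hu => ?_)
      all_goals
        rw [Set.uIoc_of_le hst] at hu
        have hu0 : 0 ≤ u := hs.trans hu.1.le
      · rw [Real.norm_of_nonneg (hRn K u hu0)]
        exact hRq K u hu0
      · exact hRlim u hu0
    simpa using this
  have hGint : ∀ a, 0 ≤ a → G a = (∫ u in β..(a + β), G u) - ∫ u in (0 : ℝ)..a, G u := by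
    intro a ha
    have e : ∀ K, D (K + 1) a = (∫ u in β..(a + β), D K u) + (∫ u in β..(a + β), R K u) -
        ∫ u in (0 : ℝ)..a, D (K + 1) u := by
      intro K
      have c1 : Continuous fun u => D K (u + β) := (hDc K).comp (continuous_add_const β)
      have c2 : Continuous fun u => R K (u + β) := (hRc K).comp (continuous_add_const β)
      have c12 : Continuous fun u => D K (u + β) + R K (u + β) := c1.add c2
      have h := intervalIntegral.integral_eq_sub_of_hasDerivAt (a := 0) (b := a)
        (fun u _ => hDd K u) ((c12.sub (hDc (K + 1))).intervalIntegrable _ _)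
      rw [hD0, sub_zero] at h
      rw [← h, intervalIntegral.integral_sub (c12.intervalIntegrable _ _)
        ((hDc (K + 1)).intervalIntegrable _ _),
        intervalIntegral.integral_add (c1.intervalIntegrable _ _) (c2.intervalIntegrable _ _),
        intervalIntegral.integral_comp_add_right (D K),
        intervalIntegral.integral_comp_add_right (R K), zero_add]
    have hl := (tendsto_add_atTop_iff_nat 1).2 (hDlim a ha)
    simp only [e] at hl
    have hr := ((hint β (a + β) hβ0 (by linarith)).add
      (hintR β (a + β) hβ0 (by linarith))).sub
      ((tendsto_add_atTop_iff_nat 1).2 (hint 0 a le_rfl ha))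
    simpa using tendsto_nhds_unique hl hr
  have hGi : ∀ s t, 0 ≤ s → s ≤ t → IntervalIntegrable G volume s t := by
    intro s t hs hst
    refine (hmc.intervalIntegrable s t).mono_fun' ?_ ?_
    · refine aestronglyMeasurable_of_tendsto_ae atTop
        (fun K => (hDc K).aestronglyMeasurable) ?_
      rw [Set.uIoc_of_le hst]
      filter_upwards [ae_restrict_mem measurableSet_Ioc] with u hu
      exact hDlim u (hs.trans hu.1.le)
    · rw [Set.uIoc_of_le hst]
      filter_upwards [ae_restrict_mem measurableSet_Ioc] with u hu
      have hu0 := hs.trans hu.1.le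
      rw [Real.norm_of_nonneg (hGn u hu0)]
      exact le_of_tendsto' (hDlim u hu0) fun K => hDm K u hu0
  have hGz : G a = 0 := by
    refine eq_zero_of_le_mul_bound hβ0 hβ1 hGn hC hGC (fun b hb B hB => ?_) ha
    have h1 := intervalIntegral.integral_add_adjacent_intervals
      (hGi 0 β le_rfl hβ0) (hGi β (b + β) hβ0 (by linarith))
    have h2 := intervalIntegral.integral_add_adjacent_intervals
      (hGi 0 b le_rfl hb) (hGi b (b + β) hb (by linarith))
    have h3 : 0 ≤ ∫ u in (0 : ℝ)..β, G u :=
      intervalIntegral.integral_nonneg hβ0 fun u hu => hGn u hu.1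
    have h4 : ‖∫ u in b..(b + β), G u‖ ≤ B * |b + β - b| := by
      refine intervalIntegral.norm_integral_le_of_norm_le_const fun u hu => ?_
      rw [Set.uIoc_of_le (by linarith)] at hu
      rw [Real.norm_of_nonneg (hGn u (hb.trans hu.1.le))]
      exact hB u ⟨hu.1.le, hu.2⟩
    rw [add_sub_cancel_left, abs_of_nonneg hβ0] at h4
    have h5 := (le_abs_self _).trans h4
    rw [hGint b hb]
    linarith
  have := (hsum a ha).hasSum
  rwa [← sub_eq_zero.1 hGz] at this

/-- Polynomial case of `hasSum_genPoisson_of_delay`. -/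
lemma hasSum_genPoisson_of_polynomial {β : ℝ} (hβ0 : 0 ≤ β) (hβ1 : β < 1) {w p : ℕ → ℝ}
    {q : ℝ → ℝ} (c : Fin 6 → ℝ) (hc : ∀ i, 0 ≤ c i)
    (hp : ∀ k, 0 ≤ p k) (hw : ∀ k, w (k + 1) = w k + p k) (hw0 : w 0 = c 0)
    (hqc : Continuous q)
    (hq : ∀ a, 0 ≤ a → HasSum (fun k => p k * genPoisson β k a) (q a))
    (hdelay : ∀ a, ∑ i, c i * ((i : ℕ) * a ^ ((i : ℕ) - 1)) =
      ∑ i, c i * (a + β) ^ (i : ℕ) + q (a + β) - ∑ i, c i * a ^ (i : ℕ))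
    {a : ℝ} (ha : 0 ≤ a) :
    HasSum (fun k => w k * genPoisson β k a) (∑ i, c i * a ^ (i : ℕ)) := by
  refine hasSum_genPoisson_of_delay (m := fun a => ∑ i, c i * a ^ (i : ℕ))
    (C := ∑ i, c i) (d := 5) hβ0 hβ1 hp (hw0 ▸ hc 0) hw hqc hq
    (fun a => HasDerivAt.fun_sum fun i _ => (hasDerivAt_pow (i : ℕ) a).const_mul (c i))
    hdelay ?_ (fun a ha => Finset.sum_nonneg fun i _ => mul_nonneg (hc i) (by positivity))
    (Finset.sum_nonneg fun i _ => hc i) (fun a ha => ?_) ha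
  · simp [Fin.sum_univ_succ, hw0]
  · rw [Finset.sum_mul]
    refine Finset.sum_le_sum fun i _ => mul_le_mul_of_nonneg_left ?_ (hc i)
    calc a ^ (i : ℕ) ≤ (1 + a) ^ (i : ℕ) := by gcongr; linarith
      _ ≤ (1 + a) ^ 5 := pow_le_pow_right₀ (by linarith) (by omega)

lemma hasSum_genPoisson_one {β : ℝ} (hβ0 : 0 ≤ β) (hβ1 : β < 1) {a : ℝ} (ha : 0 ≤ a) :
    HasSum (fun k => genPoisson β k a) 1 := by
  simpa [Fin.sum_univ_succ] using hasSum_genPoisson_of_polynomial (w := fun _ => 1)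
    (p := fun _ => 0) (q := fun _ => 0) hβ0 hβ1 ![1, 0, 0, 0, 0, 0]
    (by intro i; fin_cases i <;> simp) (by simp) (by simp) (by simp) continuous_const
    (by simp) (by intro a; simp [Fin.sum_univ_succ]) ha

lemma hasSum_genPoisson_pow_one {β : ℝ} (hβ0 : 0 ≤ β) (hβ1 : β < 1) {a : ℝ} (ha : 0 ≤ a) :
    HasSum (fun k : ℕ => (k : ℝ) * genPoisson β k a) (a / (1 - β)) := by
  have hd : 0 < 1 - β := sub_pos.2 hβ1
  have h := hasSum_genPoisson_of_polynomial (w := fun k => (k : ℝ))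
    (p := fun _ => 1) (q := fun _ => 1) hβ0 hβ1 ![0, 1 / (1 - β), 0, 0, 0, 0]
    (by intro i; fin_cases i <;> simp [hβ1.le]) (by simp) (by simp) (by simp)
    continuous_const
    (by intro b hb; simpa using hasSum_genPoisson_one hβ0 hβ1 hb)
    (by intro b; simp [Fin.sum_univ_succ]; field_simp; ring) ha
  convert h using 1
  simp [Fin.sum_univ_succ]; ring

lemma hasSum_genPoisson_pow_two {β : ℝ} (hβ0 : 0 ≤ β) (hβ1 : β < 1) {a : ℝ} (ha : 0 ≤ a) :
    HasSum (fun k : ℕ => (k : ℝ) ^ 2 * genPoisson β k a)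
      (a ^ 2 / (1 - β) ^ 2 + a / (1 - β) ^ 3) := by
  have hd : 0 < 1 - β := sub_pos.2 hβ1
  have h := hasSum_genPoisson_of_polynomial (w := fun k => (k : ℝ) ^ 2)
    (p := fun k => 2 * (k : ℝ) + 1) (q := fun b => 2 * (b / (1 - β)) + 1) hβ0 hβ1
    ![0, 1 / (1 - β) ^ 3, 1 / (1 - β) ^ 2, 0, 0, 0]
    (by intro i; fin_cases i <;> simp <;> positivity) (by intro k; positivity)
    (by intro k; push_cast; ring) (by simp) (by fun_prop)
    (by
      intro b hb
      simpa only [add_mul, mul_assoc, one_mul] using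
        (((hasSum_genPoisson_pow_one hβ0 hβ1 hb).mul_left 2).add
          (hasSum_genPoisson_one hβ0 hβ1 hb)))
    (by intro b; simp [Fin.sum_univ_succ]; field_simp; ring) ha
  convert h using 1
  simp [Fin.sum_univ_succ]; ring

lemma hasSum_genPoisson_pow_three {β : ℝ} (hβ0 : 0 ≤ β) (hβ1 : β < 1) {a : ℝ} (ha : 0 ≤ a) :
    HasSum (fun k : ℕ => (k : ℝ) ^ 3 * genPoisson β k a)
      (a ^ 3 / (1 - β) ^ 3 + 3 * a ^ 2 / (1 - β) ^ 4 + (1 + 2 * β) * a / (1 - β) ^ 5) := by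
  have hd : 0 < 1 - β := sub_pos.2 hβ1
  have h := hasSum_genPoisson_of_polynomial (w := fun k => (k : ℝ) ^ 3)
    (p := fun k => 3 * (k : ℝ) ^ 2 + 3 * (k : ℝ) + 1)
    (q := fun b => 3 * (b ^ 2 / (1 - β) ^ 2 + b / (1 - β) ^ 3) + 3 * (b / (1 - β)) + 1) hβ0 hβ1
    ![0, (1 + 2 * β) / (1 - β) ^ 5, 3 / (1 - β) ^ 4, 1 / (1 - β) ^ 3, 0, 0]
    (by intro i; fin_cases i <;> simp <;> positivity) (by intro k; positivity)
    (by intro k; push_cast; ring) (by simp) (by fun_prop)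
    (by
      intro b hb
      simpa only [add_mul, mul_assoc, one_mul] using
        ((((hasSum_genPoisson_pow_two hβ0 hβ1 hb).mul_left 3).add
          ((hasSum_genPoisson_pow_one hβ0 hβ1 hb).mul_left 3)).add
          (hasSum_genPoisson_one hβ0 hβ1 hb)))
    (by intro b; simp [Fin.sum_univ_succ]; field_simp; ring) ha
  convert h using 1
  simp [Fin.sum_univ_succ]; ring

lemma hasSum_genPoisson_pow_four {β : ℝ} (hβ0 : 0 ≤ β) (hβ1 : β < 1) {a : ℝ} (ha : 0 ≤ a) :
    HasSum (fun k : ℕ => (k : ℝ) ^ 4 * genPoisson β k a)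
      (a ^ 4 / (1 - β) ^ 4 + 6 * a ^ 3 / (1 - β) ^ 5 + (7 + 8 * β) * a ^ 2 / (1 - β) ^ 6 +
        (6 * β ^ 2 + 8 * β + 1) * a / (1 - β) ^ 7) := by
  have hd : 0 < 1 - β := sub_pos.2 hβ1
  have h := hasSum_genPoisson_of_polynomial (w := fun k => (k : ℝ) ^ 4)
    (p := fun k => 4 * (k : ℝ) ^ 3 + 6 * (k : ℝ) ^ 2 + 4 * (k : ℝ) + 1)
    (q := fun b =>
      4 * (b ^ 3 / (1 - β) ^ 3 + 3 * b ^ 2 / (1 - β) ^ 4 + (1 + 2 * β) * b / (1 - β) ^ 5) +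
        6 * (b ^ 2 / (1 - β) ^ 2 + b / (1 - β) ^ 3) + 4 * (b / (1 - β)) + 1) hβ0 hβ1
    ![0, (6 * β ^ 2 + 8 * β + 1) / (1 - β) ^ 7, (7 + 8 * β) / (1 - β) ^ 6, 6 / (1 - β) ^ 5,
      1 / (1 - β) ^ 4, 0]
    (by intro i; fin_cases i <;> simp <;> positivity) (by intro k; positivity)
    (by intro k; push_cast; ring) (by simp) (by fun_prop)
    (by
      intro b hb
      simpa only [add_mul, mul_assoc, one_mul] using
        (((((hasSum_genPoisson_pow_three hβ0 hβ1 hb).mul_left 4).add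
          ((hasSum_genPoisson_pow_two hβ0 hβ1 hb).mul_left 6)).add
          ((hasSum_genPoisson_pow_one hβ0 hβ1 hb).mul_left 4)).add
          (hasSum_genPoisson_one hβ0 hβ1 hb)))
    (by intro b; simp [Fin.sum_univ_succ]; field_simp; ring) ha
  convert h using 1
  simp [Fin.sum_univ_succ]; ring

lemma hasSum_genPoisson_pow_five {β : ℝ} (hβ0 : 0 ≤ β) (hβ1 : β < 1) {a : ℝ} (ha : 0 ≤ a) :
    HasSum (fun k : ℕ => (k : ℝ) ^ 5 * genPoisson β k a)
      (a ^ 5 / (1 - β) ^ 5 + 10 * a ^ 4 / (1 - β) ^ 6 + 5 * (4 * β + 5) * a ^ 3 / (1 - β) ^ 7 +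
        15 * (2 * β ^ 2 + 4 * β + 1) * a ^ 2 / (1 - β) ^ 8 +
        (24 * β ^ 3 + 58 * β ^ 2 + 22 * β + 1) * a / (1 - β) ^ 9) := by
  have hd : 0 < 1 - β := sub_pos.2 hβ1
  have h := hasSum_genPoisson_of_polynomial (w := fun k => (k : ℝ) ^ 5)
    (p := fun k => 5 * (k : ℝ) ^ 4 + 10 * (k : ℝ) ^ 3 + 10 * (k : ℝ) ^ 2 + 5 * (k : ℝ) + 1)
    (q := fun b =>
      5 * (b ^ 4 / (1 - β) ^ 4 + 6 * b ^ 3 / (1 - β) ^ 5 + (7 + 8 * β) * b ^ 2 / (1 - β) ^ 6 +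
        (6 * β ^ 2 + 8 * β + 1) * b / (1 - β) ^ 7) +
        10 * (b ^ 3 / (1 - β) ^ 3 + 3 * b ^ 2 / (1 - β) ^ 4 + (1 + 2 * β) * b / (1 - β) ^ 5) +
        10 * (b ^ 2 / (1 - β) ^ 2 + b / (1 - β) ^ 3) + 5 * (b / (1 - β)) + 1) hβ0 hβ1
    ![0, (24 * β ^ 3 + 58 * β ^ 2 + 22 * β + 1) / (1 - β) ^ 9,
      15 * (2 * β ^ 2 + 4 * β + 1) / (1 - β) ^ 8, 5 * (4 * β + 5) / (1 - β) ^ 7,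
      10 / (1 - β) ^ 6, 1 / (1 - β) ^ 5]
    (by intro i; fin_cases i <;> simp <;> positivity) (by intro k; positivity)
    (by intro k; push_cast; ring) (by simp) (by fun_prop)
    (by
      intro b hb
      simpa only [add_mul, mul_assoc, one_mul] using
        ((((((hasSum_genPoisson_pow_four hβ0 hβ1 hb).mul_left 5).add
          ((hasSum_genPoisson_pow_three hβ0 hβ1 hb).mul_left 10)).add
          ((hasSum_genPoisson_pow_two hβ0 hβ1 hb).mul_left 10)).add
          ((hasSum_genPoisson_pow_one hβ0 hβ1 hb).mul_left 5)).add
          (hasSum_genPoisson_one hβ0 hβ1 hb)))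
    (by intro b; simp [Fin.sum_univ_succ]; field_simp; ring) ha
  convert h using 1
  simp [Fin.sum_univ_succ]; ring

lemma jainL_succ (n : ℕ) (β : ℝ) (k : ℕ) (x : ℝ) :
    jainL n β (k + 1) x = genPoisson β (k + 1) (n * x) := by
  simp [jainL, genPoisson]

lemma jainB_pow {n : ℕ} {β x s : ℝ} {r : ℕ} (hr : r ≠ 0)
    (h : HasSum (fun k : ℕ => (k : ℝ) ^ r * genPoisson β k (n * x)) s) :
    jainB n β (fun t => t ^ r) x = s / (n : ℝ) ^ r := by
  rw [jainB, ← h.tsum_eq, ← tsum_div_const]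
  refine tsum_congr fun k => ?_
  cases k with
  | zero => simp [hr]
  | succ k => rw [jainL_succ, div_pow]; ring

theorem jainB_moments (n : ℕ) (hn : 0 < n) (β : ℝ) (hβ0 : 0 ≤ β) (hβ1 : β < 1)
    (x : ℝ) (hx : 0 ≤ x) :
    jainB n β (fun t => t ^ 3) x =
        x ^ 3 / (1 - β) ^ 3 + 3 * x ^ 2 / ((n : ℝ) * (1 - β) ^ 4) +
          (1 + 2 * β) * x / ((n : ℝ) ^ 2 * (1 - β) ^ 5) ∧
    jainB n β (fun t => t ^ 4) x =
        x ^ 4 / (1 - β) ^ 4 + 6 * x ^ 3 / ((n : ℝ) * (1 - β) ^ 5) +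
          (7 + 8 * β) * x ^ 2 / ((n : ℝ) ^ 2 * (1 - β) ^ 6) +
          (6 * β ^ 2 + 8 * β + 1) * x / ((n : ℝ) ^ 3 * (1 - β) ^ 7) ∧
    jainB n β (fun t => t ^ 5) x =
        x ^ 5 / (1 - β) ^ 5 + 10 * x ^ 4 / ((n : ℝ) * (1 - β) ^ 6) +
          5 * (4 * β + 5) * x ^ 3 / ((n : ℝ) ^ 2 * (1 - β) ^ 7) +
          15 * (2 * β ^ 2 + 4 * β + 1) * x ^ 2 / ((n : ℝ) ^ 3 * (1 - β) ^ 8) +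
          (24 * β ^ 3 + 58 * β ^ 2 + 22 * β + 1) * x / ((n : ℝ) ^ 4 * (1 - β) ^ 9) := by
  have hd : 1 - β ≠ 0 := (sub_pos.2 hβ1).ne'
  have hn' : (n : ℝ) ≠ 0 := by positivity
  have ha : 0 ≤ (n : ℝ) * x := by positivity
  refine ⟨?_, ?_, ?_⟩
  · rw [jainB_pow three_ne_zero (hasSum_genPoisson_pow_three hβ0 hβ1 ha)]
    field_simp
  · rw [jainB_pow four_ne_zero (hasSum_genPoisson_pow_four hβ0 hβ1 ha)]
    field_simp
  · rw [jainB_pow (by norm_num) (hasSum_genPoisson_pow_five hβ0 hβ1 ha)]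
    field_simp
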